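/- Let D ⊆ R be integral domains with quotient fields K and L respectively, and suppose that the field extension K ⊆ L is algebraic. Then R is pseudo-polynomial over D if and only if every principal ideal of R is generated by an element of D. (In particular, every nonzero principal integral ideal of R meets D nontrivially.) -/

import Mathlib

/-- The quotient field of a subring `D` of a field `F`, realized as the subfield of `F`
generated by `D` (its elements are exactly the fractions `a/b` with `a, b ∈ D`, `b ≠ 0`). -/
def quotField {F : Type*} [Field F] (D : Subring F) : Subfield F :=
  Subfield.closure (D : Set F)

/-- An integral ideal `I` of `R` is *unitary* with respect to `D` if `I ∩ K ≠ (0)`,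
where `K` is the quotient field of `D`. -/
def IsUnitaryIdeal {F : Type*} [Field F] (D R : Subring F) (I : Ideal R) : Prop :=
  ∃ x : R, x ∈ I ∧ x ≠ 0 ∧ (x : F) ∈ quotField D

/-- `R` is *pseudo-polynomial* over `D` if every principal integral ideal of `R` that is
unitary with respect to `D` is generated by an element of `D`. -/
def IsPseudoPoly {F : Type*} [Field F] (D R : Subring F) : Prop :=
  ∀ r : R, IsUnitaryIdeal D R (Ideal.span {r}) →
    ∃ d : R, (d : F) ∈ D ∧ Ideal.span {r} = Ideal.span {d}

/-- A nonzero element of `R` that is algebraic over `D ≤ R` has a nonzero multiple in `D`. -/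
theorem exists_mem_span_singleton_of_isAlgebraic {F : Type*} [Field F] {D R : Subring F}
    (hDR : D ≤ R) {r : R} (halg : IsAlgebraic D (r : F)) (hr : r ≠ 0) :
    ∃ a : R, a ∈ Ideal.span {r} ∧ a ≠ 0 ∧ (a : F) ∈ D := by
  let _ : Algebra D R := (Subring.inclusion hDR).toAlgebra
  have : IsScalarTower D R F := IsScalarTower.of_algebraMap_eq fun _ => rfl
  have hrD : IsAlgebraic D r :=
    (isAlgebraic_algebraMap_iff (A := F) Subtype.val_injective).1 halg
  obtain ⟨d, hd, hdvd⟩ := hrD.exists_nonzero_dvd (mem_nonZeroDivisors_of_ne_zero hr)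
  refine ⟨Subring.inclusion hDR d, Ideal.mem_span_singleton.2 hdvd, fun h => hd ?_, d.2⟩
  exact Subring.inclusion_injective hDR (h.trans (map_zero _).symm)

/-- Let `D ⊆ R` be integral domains with quotient fields `K ⊆ L`,
and suppose `L/K` is algebraic (we model `L` as the ambient field `F`, a fraction
field of `R`; algebraicity over `D` is the same as over `K`).  Then `R` is
pseudo-polynomial over `D` iff every principal ideal of `R` is generated by an element
of `D`.  (In particular, every nonzero principal integral ideal of `R` meets `D`
nontrivially.) -/
theorem isPseudoPoly_iff_of_algebraic {F : Type*} [Field F] (D R : Subring F)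
    (hDR : D ≤ R) [IsFractionRing R F]
    (halg : ∀ x : F, IsAlgebraic D x) :
    (IsPseudoPoly D R ↔
      ∀ r : R, ∃ d : R, (d : F) ∈ D ∧ Ideal.span {r} = Ideal.span {d}) ∧
    (∀ r : R, r ≠ 0 → ∃ a : R, a ∈ Ideal.span {r} ∧ a ≠ 0 ∧ (a : F) ∈ D) := by
  have key (r : R) (hr : r ≠ 0) : ∃ a : R, a ∈ Ideal.span {r} ∧ a ≠ 0 ∧ (a : F) ∈ D :=
    exists_mem_span_singleton_of_isAlgebraic hDR (halg r) hr
  refine ⟨⟨fun h r => ?_, fun h r _ => h r⟩, key⟩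
  by_cases hr : r = 0
  · exact ⟨0, D.zero_mem, by rw [hr]⟩
  · obtain ⟨a, ha, ha0, haD⟩ := key r hr
    exact h r ⟨a, ha, ha0, Subfield.subset_closure haD⟩
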